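/- (Extended Coppel inequality.) Let (N_t)_{t∈ℝ} be a family of norms on ℝ^n, let t₁ < t₂, let A : [t₁,t₂] → ℝ^{n×n} be continuous except at finitely many points, and let x : [t₁,t₂] → ℝ^n be continuous and differentiable at all but finitely many points with x'(t) = A(t)·x(t) there. Assume: (i) the map t ↦ N_t(x(t)) is continuous on [t₁,t₂]; (ii) there is a piecewise continuous function α : [t₁,t₂] → ℝ such that the switched matrix measure satisfies ν_t(A(t)) ≤ α(t) for all but finitely many t ∈ [t₁,t₂); (iii) the norms are uniformly equivalent: there is D > 0 with N_s(y) ≤ D·N_t(y) for all y ∈ ℝ^n and s,t ∈ [t₁,t₂]. Then N_{t₂}(x(t₂)) ≤ exp(∫_{t₁}^{t₂} α(τ) dτ) · N_{t₁}(x(t₁)). -/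

import Mathlib

open Filter Topology MeasureTheory

/-- `N` is a norm on `ℝ^n`. -/
structure IsNorm {n : ℕ} (N : (Fin n → ℝ) → ℝ) : Prop where
  nonneg : ∀ x, 0 ≤ N x
  eq_zero_iff : ∀ x, N x = 0 ↔ x = 0
  norm_smul : ∀ (c : ℝ) (x : Fin n → ℝ), N (c • x) = |c| * N x
  triangle : ∀ x y, N (x + y) ≤ N x + N y

/-- Supremum of `N'` over the unit sphere of the norm `N`. -/
noncomputable def sphereSup {n : ℕ} (N N' : (Fin n → ℝ) → ℝ) : ℝ :=
  sSup (N' '' {x | N x = 1})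

/-- Switched matrix measure with respect to the family of norms `N t`:
`ν_t(A) = limsup_{h→0+} (1/h)[ sup_{N_t(x)=1} N_{t+h}(x + hAx) − 1 ]`. -/
noncomputable def switchedMeasure {n : ℕ} (N : ℝ → (Fin n → ℝ) → ℝ) (t : ℝ)
    (A : Matrix (Fin n) (Fin n) ℝ) : EReal :=
  Filter.limsup (fun h : ℝ =>
    (((sphereSup (N t) (fun x => N (t + h) (x + h • A.mulVec x)) - 1) / h : ℝ) : EReal))
    (𝓝[>] (0:ℝ))

theorem IsNorm.continuous {n : ℕ} {N : (Fin n → ℝ) → ℝ} (hN : IsNorm N) : Continuous N := by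
  have hconv : ConvexOn ℝ Set.univ N := by
    refine ⟨convex_univ, fun x _ y _ a b ha hb _ => (hN.triangle _ _).trans ?_⟩
    rw [hN.norm_smul, hN.norm_smul, abs_of_nonneg ha, abs_of_nonneg hb, smul_eq_mul, smul_eq_mul]
  exact hconv.locallyLipschitz.continuous

theorem IsNorm.map_zero {n : ℕ} {N : (Fin n → ℝ) → ℝ} (hN : IsNorm N) : N 0 = 0 :=
  (hN.eq_zero_iff 0).2 rfl

theorem IsNorm.exists_norm_le_mul {n : ℕ} {N : (Fin n → ℝ) → ℝ} (hN : IsNorm N) :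
    ∃ C, ∀ y, ‖y‖ ≤ C * N y := by
  rcases (Metric.sphere (0 : Fin n → ℝ) 1).eq_empty_or_nonempty with hS | hS
  · refine ⟨0, fun y => ?_⟩
    by_contra! hy
    rw [zero_mul] at hy
    have hmem : ‖y‖⁻¹ • y ∈ Metric.sphere (0 : Fin n → ℝ) 1 := by
      simp [_root_.norm_smul, hy.ne']
    simp [hS] at hmem
  · obtain ⟨z, hz, hmin⟩ :=
      (isCompact_sphere (0 : Fin n → ℝ) 1).exists_isMinOn hS hN.continuous.continuousOn
    have hzpos : 0 < N z := by
      refine (hN.nonneg z).lt_of_ne fun h => ?_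
      have hz0 := (hN.eq_zero_iff z).1 h.symm
      simp [hz0] at hz
    refine ⟨(N z)⁻¹, fun y => ?_⟩
    rcases (norm_nonneg y).eq_or_lt with hy | hy
    · rw [← hy]
      exact mul_nonneg (inv_nonneg.2 hzpos.le) (hN.nonneg y)
    have hmem : ‖y‖⁻¹ • y ∈ Metric.sphere (0 : Fin n → ℝ) 1 := by
      simp [_root_.norm_smul, hy.ne']
    have hle : N z ≤ N (‖y‖⁻¹ • y) := hmin hmem
    rw [hN.norm_smul, abs_of_pos (inv_pos.2 hy), inv_mul_eq_div, le_div_iff₀ hy] at hle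
    rwa [inv_mul_eq_div, le_div_iff₀ hzpos, mul_comm]

theorem IsNorm.isCompact_unitSphere {n : ℕ} {N : (Fin n → ℝ) → ℝ} (hN : IsNorm N) :
    IsCompact {y | N y = 1} := by
  obtain ⟨C, hC⟩ := hN.exists_norm_le_mul
  refine Metric.isCompact_of_isClosed_isBounded (isClosed_eq hN.continuous continuous_const) ?_
  refine (Metric.isBounded_closedBall (x := (0 : Fin n → ℝ)) (r := C)).subset fun y hy => ?_
  have hle := hC y
  rw [Set.mem_ofPred_eq] at hy
  rw [hy, mul_one] at hle
  simpa using hle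

theorem IsNorm.le_sphereSup_mul {n : ℕ} {N N' : (Fin n → ℝ) → ℝ} (hN : IsNorm N)
    (hN' : IsNorm N') (A : Matrix (Fin n) (Fin n) ℝ) (h : ℝ) (y : Fin n → ℝ) :
    N' (y + h • A.mulVec y) ≤ sphereSup N (fun z => N' (z + h • A.mulVec z)) * N y := by
  rcases (hN.nonneg y).eq_or_lt with hy | hy
  · obtain rfl := (hN.eq_zero_iff y).1 hy.symm
    simp [hN.map_zero, hN'.map_zero]
  have hcont : Continuous fun z => N' (z + h • A.mulVec z) :=
    hN'.continuous.comp (by fun_prop)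
  have hmem : (N y)⁻¹ • y ∈ {z | N z = 1} := by
    simp [hN.norm_smul, abs_of_pos (inv_pos.2 hy), hy.ne']
  have hle := le_csSup (hN.isCompact_unitSphere.image hcont).bddAbove
    (Set.mem_image_of_mem (fun z => N' (z + h • A.mulVec z)) hmem)
  have hsmul : (N y)⁻¹ • y + h • A.mulVec ((N y)⁻¹ • y) = (N y)⁻¹ • (y + h • A.mulVec y) := by
    rw [Matrix.mulVec_smul, smul_add, smul_comm]
  rw [hsmul, hN'.norm_smul, abs_of_pos (inv_pos.2 hy), inv_mul_le_iff₀ hy, mul_comm] at hle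
  exact hle

theorem eventually_slope_lt_of_switchedMeasure_le {n : ℕ} {N : ℝ → (Fin n → ℝ) → ℝ}
    (hN : ∀ s, IsNorm (N s)) {x : ℝ → Fin n → ℝ} {A : Matrix (Fin n) (Fin n) ℝ} {t a D r : ℝ}
    (hx : HasDerivWithinAt x (A.mulVec (x t)) (Set.Ioi t) t)
    (hν : switchedMeasure N t A ≤ (a : EReal))
    (hD : ∀ᶠ s in 𝓝[>] t, ∀ y, N s y ≤ D * N t y) (hr : a * N t (x t) < r) :
    ∀ᶠ s in 𝓝[>] t, slope (fun s => N s (x s)) t s < r := by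
  obtain ⟨b, hab, hbr⟩ : ∃ b, a < b ∧ b * N t (x t) < r := by
    have hlim : Tendsto (fun b => b * N t (x t)) (𝓝[>] a) (𝓝 (a * N t (x t))) :=
      ((continuous_id.mul continuous_const).tendsto a).mono_left nhdsWithin_le_nhds
    exact (eventually_mem_nhdsWithin.and (hlim.eventually_lt_const hr)).exists
  have hshift : Tendsto (fun s => s - t) (𝓝[>] t) (𝓝[>] (0 : ℝ)) := by
    refine tendsto_nhdsWithin_iff.2 ⟨?_, ?_⟩
    · have : Tendsto (fun s => s - t) (𝓝 t) (𝓝 (t - t)) :=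
        (continuous_id.sub continuous_const).tendsto t
      rw [sub_self] at this
      exact this.mono_left nhdsWithin_le_nhds
    · filter_upwards [self_mem_nhdsWithin] with s hs
      exact Set.mem_Ioi.2 (sub_pos.2 (Set.mem_Ioi.1 hs))
  have hS := hshift.eventually
    (eventually_lt_of_limsup_lt (hν.trans_lt (EReal.coe_lt_coe_iff.2 hab)))
  have herr : Tendsto (fun s => D * N t (slope x t s - A.mulVec (x t))) (𝓝[>] t) (𝓝 0) := by
    rw [hasDerivWithinAt_iff_tendsto_slope' (by simp)] at hx
    have h0 : Tendsto (fun s => slope x t s - A.mulVec (x t)) (𝓝[>] t) (𝓝 0) := by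
      simpa using hx.sub_const (A.mulVec (x t))
    simpa [(hN t).map_zero] using (((hN t).continuous.tendsto 0).comp h0).const_mul D
  filter_upwards [hS, herr.eventually_lt_const (sub_pos.2 hbr), hD, self_mem_nhdsWithin]
    with s hs he hDs hts
  have hh : 0 < s - t := sub_pos.2 (Set.mem_Ioi.1 hts)
  rw [EReal.coe_lt_coe_iff, div_lt_iff₀ hh, add_sub_cancel] at hs
  have hdecomp : x s = (x t + (s - t) • A.mulVec (x t))
      + (s - t) • (slope x t s - A.mulVec (x t)) := by
    rw [smul_sub, sub_smul_slope, vsub_eq_sub]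
    abel
  have hmain : N s (x s) ≤ sphereSup (N t) (fun z => N s (z + (s - t) • A.mulVec z)) * N t (x t)
      + (s - t) * (D * N t (slope x t s - A.mulVec (x t))) := by
    conv_lhs => rw [hdecomp]
    refine ((hN s).triangle _ _).trans (add_le_add ((hN t).le_sphereSup_mul (hN s) _ _ _) ?_)
    rw [(hN s).norm_smul, abs_of_pos hh]
    exact mul_le_mul_of_nonneg_left (hDs _) hh.le
  rw [slope_def_field, div_lt_iff₀ hh]
  have h1 := mul_le_mul_of_nonneg_right hs.le ((hN t).nonneg (x t))
  have h2 := mul_lt_mul_of_pos_left he hh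
  nlinarith

theorem le_exp_integral_mul_of_slope_lt {f β : ℝ → ℝ} {c d : ℝ} (hcd : c ≤ d) (hβ : Continuous β)
    (hf : ContinuousOn f (Set.Icc c d)) (hc : 0 ≤ f c)
    (hslope : ∀ t ∈ Set.Ico c d, ∀ r, β t * f t < r → ∃ᶠ s in 𝓝[>] t, slope f t s < r) :
    f d ≤ Real.exp (∫ τ in c..d, β τ) * f c := by
  have hε : ∀ ε > 0, f d ≤ Real.exp ((∫ τ in c..d, β τ) + ε * (d - c)) * (f c + ε) := by
    intro ε hε
    have hderiv : ∀ t, HasDerivAt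
        (fun t => Real.exp ((∫ τ in c..t, β τ) + ε * (t - c)) * (f c + ε))
        (Real.exp ((∫ τ in c..t, β τ) + ε * (t - c)) * (β t + ε) * (f c + ε)) t := by
      intro t
      have h1 := (hβ.integral_hasStrictDerivAt c t).hasDerivAt
      have h2 := ((hasDerivAt_id t).sub_const c).const_mul ε
      rw [mul_one] at h2
      exact (h1.add h2).exp.mul_const _
    refine image_le_of_liminf_slope_right_lt_deriv_boundary' hf hslope (by simp [hε.le])
      (fun t _ => (hderiv t).continuousAt.continuousWithinAt)
      (fun t _ => (hderiv t).hasDerivWithinAt) (fun t _ hft => ?_) (Set.right_mem_Icc.2 hcd)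
    rw [hft]
    have hpos : 0 < Real.exp ((∫ τ in c..t, β τ) + ε * (t - c)) * (f c + ε) := by positivity
    nlinarith
  have hlim : Tendsto (fun ε => Real.exp ((∫ τ in c..d, β τ) + ε * (d - c)) * (f c + ε)) (𝓝[>] 0)
      (𝓝 (Real.exp ((∫ τ in c..d, β τ) + 0 * (d - c)) * (f c + 0))) :=
    ((by fun_prop : Continuous fun ε =>
      Real.exp ((∫ τ in c..d, β τ) + ε * (d - c)) * (f c + ε)).tendsto 0).mono_left
        nhdsWithin_le_nhds
  rw [zero_mul, add_zero, add_zero] at hlim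
  exact ge_of_tendsto hlim (eventually_nhdsWithin_of_forall hε)

theorem le_exp_integral_mul_of_slope_lt_Ioo {f β : ℝ → ℝ} {c d : ℝ} (hcd : c < d)
    (hβ : Continuous β) (hf : ContinuousOn f (Set.Icc c d)) (hf0 : ∀ t ∈ Set.Icc c d, 0 ≤ f t)
    (hslope : ∀ t ∈ Set.Ioo c d, ∀ r, β t * f t < r → ∃ᶠ s in 𝓝[>] t, slope f t s < r) :
    f d ≤ Real.exp (∫ τ in c..d, β τ) * f c := by
  have hint : Continuous fun e => ∫ τ in e..d, β τ := by
    simp_rw [intervalIntegral.integral_symm d]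
    exact (intervalIntegral.continuous_primitive (fun a b => hβ.intervalIntegrable a b) d).neg
  have hfc : Tendsto f (𝓝[>] c) (𝓝 (f c)) := by
    rw [← nhdsWithin_Ioo_eq_nhdsGT hcd]
    exact (hf c (Set.left_mem_Icc.2 hcd.le)).mono_left (nhdsWithin_mono _ Set.Ioo_subset_Icc_self)
  refine ge_of_tendsto
    (((Real.continuous_exp.comp hint).tendsto c |>.mono_left nhdsWithin_le_nhds).mul hfc) ?_
  filter_upwards [Ioo_mem_nhdsGT hcd] with e he
  exact le_exp_integral_mul_of_slope_lt he.2.le hβ (hf.mono (Set.Icc_subset_Icc_left he.1.le))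
    (hf0 e (Set.Ioo_subset_Icc_self he)) fun t ht => hslope t ⟨he.1.trans_le ht.1, ht.2⟩

theorem exists_continuous_eqOn_Ioo {α : ℝ → ℝ} {c d : ℝ} (hcd : c < d)
    (hα : ContinuousOn α (Set.Ioo c d)) (hc : ∃ L, Tendsto α (𝓝[>] c) (𝓝 L))
    (hd : ∃ L, Tendsto α (𝓝[<] d) (𝓝 L)) :
    ∃ β : ℝ → ℝ, Continuous β ∧ Set.EqOn β α (Set.Ioo c d) := by
  obtain ⟨Lc, hLc⟩ := hc
  obtain ⟨Ld, hLd⟩ := hd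
  have hcont := continuousOn_Icc_extendFrom_Ioo hα hLc hLd
  refine ⟨Set.IccExtend hcd.le ((Set.Icc c d).domRestrict (extendFrom (Set.Ioo c d) α)),
    (continuousOn_iff_continuous_domRestrict.1 hcont).Icc_extend', fun t ht => ?_⟩
  rw [Set.IccExtend_of_mem _ _ (Set.Ioo_subset_Icc_self ht), Set.domRestrict_apply]
  exact extendFrom_extends hα t ht

theorem exists_tendsto_nhdsGT_of_piecewise {α : ℝ → ℝ} {a b t : ℝ} {F : Finset ℝ}
    (hcont : ∀ t ∈ Set.Icc a b, t ∉ F → ContinuousWithinAt α (Set.Icc a b) t)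
    (hlim : ∀ t ∈ F, ∃ L, Tendsto α (𝓝[>] t) (𝓝 L)) (ht : t ∈ Set.Ico a b) :
    ∃ L, Tendsto α (𝓝[>] t) (𝓝 L) := by
  by_cases htF : t ∈ F
  · exact hlim t htF
  refine ⟨α t, ?_⟩
  rw [← nhdsWithin_Ioo_eq_nhdsGT ht.2]
  exact (hcont t (Set.Ico_subset_Icc_self ht) htF).mono_left
    (nhdsWithin_mono _ (Set.Ioo_subset_Icc_self.trans (Set.Icc_subset_Icc_left ht.1)))

theorem exists_tendsto_nhdsLT_of_piecewise {α : ℝ → ℝ} {a b t : ℝ} {F : Finset ℝ}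
    (hcont : ∀ t ∈ Set.Icc a b, t ∉ F → ContinuousWithinAt α (Set.Icc a b) t)
    (hlim : ∀ t ∈ F, ∃ L, Tendsto α (𝓝[<] t) (𝓝 L)) (ht : t ∈ Set.Ioc a b) :
    ∃ L, Tendsto α (𝓝[<] t) (𝓝 L) := by
  by_cases htF : t ∈ F
  · exact hlim t htF
  refine ⟨α t, ?_⟩
  rw [← nhdsWithin_Ioo_eq_nhdsLT ht.1]
  exact (hcont t (Set.Ioc_subset_Icc_self ht) htF).mono_left
    (nhdsWithin_mono _ (Set.Ioo_subset_Icc_self.trans (Set.Icc_subset_Icc_right ht.2)))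

/-- A transitive relation between points of `[a, b]` which holds across every subinterval whose
interior avoids a finite set holds between `a` and `b`. -/
theorem rel_of_forall_disjoint_finset {P : ℝ → ℝ → Prop} (F : Finset ℝ) {a b : ℝ} (hab : a < b)
    (htrans : ∀ p q r, P p q → P q r → P p r)
    (hP : ∀ c d, a ≤ c → c < d → d ≤ b → (∀ t ∈ Set.Ioo c d, t ∉ F) → P c d) : P a b := by
  induction F using Finset.induction_on generalizing a b with
  | empty => exact hP a b le_rfl hab le_rfl (by simp)
  | insert p F _ ih =>
    by_cases hp : p ∈ Set.Ioo a b
    · refine htrans a p b (ih hp.1 fun c d hac hcd hdp hF => ?_)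
        (ih hp.2 fun c d hpc hcd hdb hF => ?_)
      · refine hP c d hac hcd (hdp.trans hp.2.le) fun t ht => ?_
        simp [hF t ht, (ht.2.trans_le hdp).ne]
      · refine hP c d (hp.1.le.trans hpc) hcd hdb fun t ht => ?_
        simp [hF t ht, (hpc.trans_lt ht.1).ne']
    · refine ih hab fun c d hac hcd hdb hF => hP c d hac hcd hdb fun t ht => ?_
      have htp : t ≠ p := by
        rintro rfl
        exact hp ⟨hac.trans_lt ht.1, ht.2.trans_le hdb⟩
      simp [hF t ht, htp]

/-- extended Coppel inequality:
`N_{t₂}(x(t₂)) ≤ exp(∫_{t₁}^{t₂} α) · N_{t₁}(x(t₁))`. -/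
theorem extended_coppel_inequality
    {n : ℕ} (N : ℝ → (Fin n → ℝ) → ℝ) (hN : ∀ s, IsNorm (N s))
    (t₁ t₂ : ℝ) (ht : t₁ < t₂)
    (A : ℝ → Matrix (Fin n) (Fin n) ℝ)
    -- `A` is continuous except at finitely many points
    (hA : ∃ F : Finset ℝ, ∀ t ∈ Set.Icc t₁ t₂, t ∉ F →
      ∀ i j, ContinuousWithinAt (fun s => A s i j) (Set.Icc t₁ t₂) t)
    (x : ℝ → Fin n → ℝ)
    -- `x` is continuous and differentiable at all but finitely many points,
    -- with `x'(t) = A(t)·x(t)` there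
    (hxc : ContinuousOn x (Set.Icc t₁ t₂))
    (hx : ∃ F : Finset ℝ, ∀ t ∈ Set.Icc t₁ t₂, t ∉ F →
      HasDerivWithinAt x ((A t).mulVec (x t)) (Set.Icc t₁ t₂) t)
    -- (i) the map `t ↦ N_t(x(t))` is continuous on `[t₁,t₂]`
    (hNx : ContinuousOn (fun t => N t (x t)) (Set.Icc t₁ t₂))
    -- (ii) `α` is piecewise continuous and bounds the switched matrix measure
    (α : ℝ → ℝ)
    (hα : ∃ F : Finset ℝ,
      (∀ t ∈ Set.Icc t₁ t₂, t ∉ F → ContinuousWithinAt α (Set.Icc t₁ t₂) t) ∧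
      (∀ t ∈ F, (∃ L, Tendsto α (𝓝[<] t) (𝓝 L)) ∧ (∃ L, Tendsto α (𝓝[>] t) (𝓝 L))))
    (hνα : ∃ F : Finset ℝ, ∀ t ∈ Set.Ico t₁ t₂, t ∉ F →
      switchedMeasure N t (A t) ≤ ((α t : ℝ) : EReal))
    -- (iii) the norms are uniformly equivalent on `[t₁,t₂]`
    (D : ℝ) (hD : 0 < D)
    (hunif : ∀ (y : Fin n → ℝ), ∀ s ∈ Set.Icc t₁ t₂, ∀ t ∈ Set.Icc t₁ t₂,
      N s y ≤ D * N t y) :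
    N t₂ (x t₂) ≤ Real.exp (∫ τ in t₁..t₂, α τ) * N t₁ (x t₁) := by
  classical
  obtain ⟨Fx, hx⟩ := hx
  obtain ⟨Fα, hαc, hαl⟩ := hα
  obtain ⟨Fν, hνα⟩ := hνα
  suffices h : IntervalIntegrable α volume t₁ t₂ ∧
      N t₂ (x t₂) ≤ Real.exp (∫ τ in t₁..t₂, α τ) * N t₁ (x t₁) from h.2
  refine rel_of_forall_disjoint_finset
    (P := fun c d => IntervalIntegrable α volume c d ∧
      N d (x d) ≤ Real.exp (∫ τ in c..d, α τ) * N c (x c)) (Fx ∪ Fα ∪ Fν) ht ?_ ?_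
  · rintro p q r ⟨hpq, hpq'⟩ ⟨hqr, hqr'⟩
    refine ⟨hpq.trans hqr, hqr'.trans ?_⟩
    rw [← intervalIntegral.integral_add_adjacent_intervals hpq hqr, add_comm, Real.exp_add,
      mul_assoc]
    exact mul_le_mul_of_nonneg_left hpq' (Real.exp_pos _).le
  · intro c d hac hcd hdb hF
    simp only [Finset.mem_union, not_or] at hF
    have hsub : Set.Icc c d ⊆ Set.Icc t₁ t₂ := Set.Icc_subset_Icc hac hdb
    have hsub' : Set.Ioo c d ⊆ Set.Icc t₁ t₂ := Set.Ioo_subset_Icc_self.trans hsub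
    obtain ⟨β, hβ, hβα⟩ := exists_continuous_eqOn_Ioo hcd
      (fun t h => (hαc t (hsub' h) (hF t h).1.2).mono hsub')
      (exists_tendsto_nhdsGT_of_piecewise hαc (fun t h => (hαl t h).2)
        ⟨hac, hcd.trans_le hdb⟩)
      (exists_tendsto_nhdsLT_of_piecewise hαc (fun t h => (hαl t h).1)
        ⟨hac.trans_lt hcd, hdb⟩)
    rw [← Set.uIoo_of_lt hcd] at hβα
    refine ⟨(hβ.intervalIntegrable c d).congr_uIoo hβα, ?_⟩
    rw [← intervalIntegral.integral_congr_uIoo hβα]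
    rw [Set.uIoo_of_lt hcd] at hβα
    refine le_exp_integral_mul_of_slope_lt_Ioo hcd hβ (hNx.mono hsub)
      (fun t _ => (hN t).nonneg _) fun t h r hr => Eventually.frequently ?_
    have htt : t < t₂ := h.2.trans_le hdb
    have hmem : t ∈ Set.Icc t₁ t₂ := hsub' h
    rw [hβα h] at hr
    refine eventually_slope_lt_of_switchedMeasure_le hN (D := D) ?_
      (hνα t ⟨hmem.1, htt⟩ (hF t h).2) ?_ hr
    · exact (hx t hmem (hF t h).1.1).mono_of_mem_nhdsWithin
        (mem_of_superset (Ioo_mem_nhdsGT htt)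
          (Set.Ioo_subset_Icc_self.trans (Set.Icc_subset_Icc_left hmem.1)))
    · filter_upwards [Ioo_mem_nhdsGT htt] with s hs y
      exact hunif y s ⟨hmem.1.trans hs.1.le, hs.2.le⟩ t hmem
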